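/- arXiv:2001.10318 — 2 statements merged into one kernel-verified Lean document; each statement's English description precedes it below -/
import Mathlib

section
/- Let P be a noiseless, finitely supported probability distribution on 𝒳 × {-1,1}. A model f : 𝒳 → [-1,1] is lossless with respect to P (i.e., I_P(f(X); Y) = I_P(X; Y)) if and only if there exists an injective (invertible onto its image) map g : [-1,1] → ℝ such that R_P(g ∘ f) = 0. -/
open Finset

noncomputable section

/-- The binary label space `𝒴 = {-1, 1} ⊆ ℤ`. -/
abbrev Ybin : Type := ({-1, 1} : Finset ℤ)

/-- The label `+1` as an element of `Ybin`. -/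
def yPos : Ybin := ⟨1, by decide⟩

/-- The label `-1` as an element of `Ybin`. -/
def yNeg : Ybin := ⟨-1, by decide⟩

/-- Probability of a set under a finitely supported pmf `P`. -/
def pr {Ω : Type*} [Fintype Ω] (P : Ω → ℝ) (s : Set Ω) : ℝ :=
  ∑ ω, s.indicator P ω

/-- Entropy `H_P(A)` of a random variable `A` (a function of the sample point),
`H_P(A) = -∑_a P(A=a) log P(A=a)`, written as a sum over sample points. -/
def ent {Ω α : Type*} [Fintype Ω] (P : Ω → ℝ) (A : Ω → α) : ℝ :=
  -∑ ω, P ω * Real.log (pr P {ω' | A ω' = A ω})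

/-- Conditional entropy `H_P(A|B) = -∑_{a,b} P(A=a,B=b) log P(A=a|B=b)`. -/
def condEnt {Ω α β : Type*} [Fintype Ω] (P : Ω → ℝ) (A : Ω → α) (B : Ω → β) : ℝ :=
  -∑ ω, P ω * Real.log (pr P {ω' | A ω' = A ω ∧ B ω' = B ω} / pr P {ω' | B ω' = B ω})

/-- Mutual information `I_P(A;B) = ∑_{a,b} P(A=a,B=b) log (P(A=a,B=b) / (P(A=a) P(B=b)))`. -/
def mi {Ω α β : Type*} [Fintype Ω] (P : Ω → ℝ) (A : Ω → α) (B : Ω → β) : ℝ :=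
  ∑ ω, P ω * Real.log (pr P {ω' | A ω' = A ω ∧ B ω' = B ω} /
      (pr P {ω' | A ω' = A ω} * pr P {ω' | B ω' = B ω}))

/-- Marginal `P_X(x) = ∑_y P(x,y)`. -/
def margX {𝒳 : Type*} [Fintype 𝒳] (P : 𝒳 × Ybin → ℝ) (x : 𝒳) : ℝ :=
  ∑ y, P (x, y)

/-- Risk `R_P(h) = P[sign(h(X)) ≠ Y]`. -/
def risk {𝒳 : Type*} [Fintype 𝒳] (P : 𝒳 × Ybin → ℝ) (h : 𝒳 → ℝ) : ℝ :=
  pr P {ω | Real.sign (h ω.1) ≠ ((ω.2 : ℤ) : ℝ)}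


section FinitePmf

variable {Ω α β : Type*} [Fintype Ω] {P : Ω → ℝ}

lemma pr_mono (hP : ∀ ω, 0 ≤ P ω) {s t : Set Ω} (hst : s ⊆ t) : pr P s ≤ pr P t :=
  Finset.sum_le_sum fun _ _ => Set.indicator_le_indicator_of_subset hst hP _

lemma pr_eq_zero_iff (hP : ∀ ω, 0 ≤ P ω) {s : Set Ω} : pr P s = 0 ↔ ∀ ω ∈ s, P ω = 0 := by
  unfold pr
  rw [Finset.sum_eq_zero_iff_of_nonneg fun ω _ => Set.indicator_nonneg (fun x _ => hP x) ω]
  simp [Set.indicator_apply_eq_zero]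

lemma pr_pos (hP : ∀ ω, 0 ≤ P ω) {s : Set Ω} {ω : Ω} (hs : ω ∈ s) (hω : 0 < P ω) :
    0 < pr P s := by
  refine lt_of_le_of_ne (Finset.sum_nonneg fun ω _ => Set.indicator_nonneg (fun x _ => hP x) ω) ?_
  intro h
  exact hω.ne' ((pr_eq_zero_iff hP).1 h.symm ω hs)

lemma pr_eq_pr_iff_of_subset (hP : ∀ ω, 0 ≤ P ω) {s t : Set Ω} (hst : s ⊆ t) :
    pr P s = pr P t ↔ ∀ ω ∈ t, 0 < P ω → ω ∈ s := by
  unfold pr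
  rw [Finset.sum_eq_sum_iff_of_le (f := s.indicator P) (g := t.indicator P)
    fun _ _ => Set.indicator_le_indicator_of_subset hst hP _]
  constructor
  · intro h ω ht hω
    by_contra hs
    have := h ω (Finset.mem_univ ω)
    rw [Set.indicator_of_notMem hs, Set.indicator_of_mem ht] at this
    exact hω.ne this
  · intro h ω _
    by_cases ht : ω ∈ t
    · rcases (hP ω).eq_or_lt with h0 | hpos
      · simp [Set.indicator, ← h0]
      · rw [Set.indicator_of_mem ht, Set.indicator_of_mem (h ω ht hpos)]
    · rw [Set.indicator_of_notMem ht, Set.indicator_of_notMem fun hs => ht (hst hs)]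

/-- The chain rule `I(A;B) = H(B) - H(B|A)`. -/
lemma mi_eq_ent_sub_condEnt (hP : ∀ ω, 0 ≤ P ω) (A : Ω → α) (B : Ω → β) :
    mi P A B = ent P B - condEnt P B A := by
  unfold mi ent condEnt
  rw [sub_neg_eq_add, ← Finset.sum_neg_distrib, ← Finset.sum_add_distrib]
  refine Finset.sum_congr rfl fun ω _ => ?_
  rcases (hP ω).eq_or_lt with h0 | hpos
  · simp [← h0]
  have hA : 0 < pr P {ω' | A ω' = A ω} := pr_pos hP rfl hpos
  have hB : 0 < pr P {ω' | B ω' = B ω} := pr_pos hP rfl hpos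
  have hBA : 0 < pr P {ω' | B ω' = B ω ∧ A ω' = A ω} := pr_pos hP ⟨rfl, rfl⟩ hpos
  simp only [and_comm (a := A _ = A ω)]
  rw [Real.log_div hBA.ne' (mul_pos hA hB).ne', Real.log_div hBA.ne' hA.ne',
    Real.log_mul hA.ne' hB.ne']
  ring

/-- `H(B|A)` vanishes iff `B` is almost surely a function of `A`. -/
lemma condEnt_eq_zero_iff (hP : ∀ ω, 0 ≤ P ω) (B : Ω → β) (A : Ω → α) :
    condEnt P B A = 0 ↔ ∀ ω ω', 0 < P ω → 0 < P ω' → A ω' = A ω → B ω' = B ω := by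
  have hsub (ω : Ω) : {ω' | B ω' = B ω ∧ A ω' = A ω} ⊆ {ω' | A ω' = A ω} := fun _ h => h.2
  have hnonpos (ω : Ω) :
      P ω * Real.log (pr P {ω' | B ω' = B ω ∧ A ω' = A ω} / pr P {ω' | A ω' = A ω}) ≤ 0 := by
    rcases (hP ω).eq_or_lt with h0 | hpos
    · simp [← h0]
    have hA : 0 < pr P {ω' | A ω' = A ω} := pr_pos hP rfl hpos
    have hBA : 0 < pr P {ω' | B ω' = B ω ∧ A ω' = A ω} := pr_pos hP ⟨rfl, rfl⟩ hpos
    exact mul_nonpos_of_nonneg_of_nonpos hpos.le <|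
      Real.log_nonpos (by positivity) ((div_le_one hA).2 (pr_mono hP (hsub ω)))
  unfold condEnt
  rw [neg_eq_zero, Finset.sum_eq_zero_iff_of_nonpos fun ω _ => hnonpos ω]
  refine forall_congr' fun ω => ?_
  simp only [Finset.mem_univ, true_imp_iff]
  rcases (hP ω).eq_or_lt with h0 | hpos
  · simp [← h0]
  have hA : 0 < pr P {ω' | A ω' = A ω} := pr_pos hP rfl hpos
  have hBA : 0 < pr P {ω' | B ω' = B ω ∧ A ω' = A ω} := pr_pos hP ⟨rfl, rfl⟩ hpos
  have hlog : Real.log (pr P {ω' | B ω' = B ω ∧ A ω' = A ω} / pr P {ω' | A ω' = A ω}) = 0 ↔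
      pr P {ω' | B ω' = B ω ∧ A ω' = A ω} = pr P {ω' | A ω' = A ω} := by
    rw [← div_eq_one_iff_eq hA.ne']
    refine ⟨fun h => Real.eq_one_of_pos_of_log_eq_zero (div_pos hBA hA) h, fun h => ?_⟩
    rw [h, Real.log_one]
  rw [mul_eq_zero, or_iff_right hpos.ne', hlog, pr_eq_pr_iff_of_subset hP (hsub ω)]
  exact ⟨fun h ω' _ hω' hAA => (h ω' hAA hω').1, fun h ω' hAA hω' => ⟨h ω' hpos hω' hAA, hAA⟩⟩

end FinitePmf

lemma risk_eq_zero_iff {𝒳 : Type*} [Fintype 𝒳] {P : 𝒳 × Ybin → ℝ} (hP : ∀ ω, 0 ≤ P ω)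
    (h : 𝒳 → ℝ) :
    risk P h = 0 ↔ ∀ ω, 0 < P ω → Real.sign (h ω.1) = ((ω.2 : ℤ) : ℝ) := by
  unfold risk
  rw [pr_eq_zero_iff hP]
  refine forall_congr' fun ω => ?_
  rw [Set.mem_ofPred_eq, not_imp_comm, (hP ω).lt_iff_ne']

/-- Let `P` be noiseless. A model `f : 𝒳 → [-1,1]` is lossless w.r.t. `P`
(`I_P(f(X);Y) = I_P(X;Y)`) iff there is an injective map `g : [-1,1] → ℝ` such that
`R_P(g ∘ f) = 0`. -/
theorem lossless_iff_exists_invertible_zero_risk {𝒳 : Type*} [Fintype 𝒳]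
    (P : 𝒳 × Ybin → ℝ) (hP0 : ∀ ω, 0 ≤ P ω) (hP1 : ∑ ω, P ω = 1)
    (hnoiseless : condEnt P (fun ω => ω.2) (fun ω => ω.1) = 0)
    (f : 𝒳 → ℝ) (hf : ∀ x, f x ∈ Set.Icc (-1 : ℝ) 1) :
    mi P (fun ω => f ω.1) (fun ω => ω.2) = mi P (fun ω => ω.1) (fun ω => ω.2) ↔
      ∃ g : ℝ → ℝ, Set.InjOn g (Set.Icc (-1 : ℝ) 1) ∧ risk P (fun x => g (f x)) = 0 := by
  classical
  rw [mi_eq_ent_sub_condEnt hP0, mi_eq_ent_sub_condEnt hP0, hnoiseless, sub_right_inj,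
    condEnt_eq_zero_iff hP0]
  simp only [risk_eq_zero_iff hP0]
  constructor
  · intro h
    let S : Set ℝ := {t | ∃ ω, 0 < P ω ∧ f ω.1 = t ∧ ω.2 = yPos}
    refine ⟨fun t => if t ∈ S then t + 2 else t - 2, ?_, ?_⟩
    · intro s hs t ht hst
      simp only [Set.mem_Icc] at hs ht
      dsimp only at hst
      split_ifs at hst <;> linarith
    · intro ω hω
      have hfω := hf ω.1
      rw [Set.mem_Icc] at hfω
      by_cases hS : f ω.1 ∈ S
      · obtain ⟨ω', hω', hff, hy⟩ := id hS
        have hωy : ω.2 = yPos := (h ω' ω hω' hω hff.symm).trans hy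
        simp only [if_pos hS]
        rw [Real.sign_of_pos (by linarith), hωy]
        simp [yPos]
      · have hωy : (ω.2 : ℤ) = -1 := by
          have hmem := ω.2.2
          simp only [Finset.mem_insert, Finset.mem_singleton] at hmem
          exact hmem.resolve_right fun h1 => hS ⟨ω, hω, rfl, Subtype.ext h1⟩
        simp only [if_neg hS]
        rw [Real.sign_of_neg (by linarith), hωy]
        simp
  · rintro ⟨g, -, hg⟩ ω ω' hω hω' hff
    have hω'y := hg ω' hω'
    rw [hff, hg ω hω] at hω'y
    exact Subtype.ext (by exact_mod_cast hω'y.symm)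
end
end

section
/- Let P be a noiseless, finitely supported probability distribution on 𝒳 × {-1,1} and let f : 𝒳 → [-1,1] be a model with R_P(f) = 0 (f correctly classifies P-almost every point). Then f is lossless: I_P(f(X); Y) = I_P(X; Y) = H_P(Y). -/
open Finset

noncomputable section

theorem pr_congr_of_support {Ω : Type*} [Fintype Ω] {P : Ω → ℝ} {s t : Set Ω}
    (h : ∀ ω, P ω ≠ 0 → (ω ∈ s ↔ ω ∈ t)) : pr P s = pr P t := by
  classical
  refine Finset.sum_congr rfl fun ω _ => ?_
  by_cases hω : P ω = 0
  · simp [Set.indicator_apply, hω]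
  · simp [Set.indicator_apply, h ω hω]

theorem le_pr_of_mem {Ω : Type*} [Fintype Ω] {P : Ω → ℝ} (hP : ∀ ω, 0 ≤ P ω) {s : Set Ω}
    {ω : Ω} (hω : ω ∈ s) : P ω ≤ pr P s := by
  rw [← Set.indicator_of_mem hω P]
  exact Finset.single_le_sum (f := s.indicator P)
    (fun ω' _ => Set.indicator_nonneg (fun ω'' _ => hP ω'') ω') (Finset.mem_univ ω)

/-- If `B` is a function of `A` on the support of `P`, then `I_P(A;B) = H_P(B)`. -/
theorem mi_eq_ent_of_determines {Ω α β : Type*} [Fintype Ω] {P : Ω → ℝ} (hP : ∀ ω, 0 ≤ P ω)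
    {A : Ω → α} {B : Ω → β}
    (h : ∀ ω ω', P ω ≠ 0 → P ω' ≠ 0 → A ω' = A ω → B ω' = B ω) : mi P A B = ent P B := by
  rw [mi, ent, ← Finset.sum_neg_distrib]
  refine Finset.sum_congr rfl fun ω _ => ?_
  by_cases hω : P ω = 0
  · simp [hω]
  have hjoint : pr P {ω' | A ω' = A ω ∧ B ω' = B ω} = pr P {ω' | A ω' = A ω} :=
    pr_congr_of_support fun ω' hω' => ⟨And.left, fun hA => ⟨hA, h ω ω' hω hω' hA⟩⟩
  have hpos : 0 < pr P {ω' | A ω' = A ω} :=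
    ((hP ω).lt_of_ne' hω).trans_le (le_pr_of_mem hP rfl)
  rw [hjoint, div_mul_cancel_left₀ hpos.ne', Real.log_inv, mul_neg]

/-- A classifier of zero risk predicts the label correctly on the support of `P`. -/
theorem sign_eq_label_of_risk_eq_zero {𝒳 : Type*} [Fintype 𝒳] {P : 𝒳 × Ybin → ℝ}
    (hP : ∀ ω, 0 ≤ P ω) {f : 𝒳 → ℝ} (hrisk : risk P f = 0) {ω : 𝒳 × Ybin} (hω : P ω ≠ 0) :
    Real.sign (f ω.1) = ((ω.2 : ℤ) : ℝ) := by
  by_contra hne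
  have hle : P ω ≤ risk P f := le_pr_of_mem hP hne
  exact hω (le_antisymm (hle.trans_eq hrisk) (hP ω))

/-- If `P` is noiseless and the model `f : 𝒳 → [-1,1]` has zero risk,
then `f` is lossless: `I_P(f(X);Y) = I_P(X;Y) = H_P(Y)`. -/
theorem zero_risk_implies_lossless {𝒳 : Type*} [Fintype 𝒳]
    (P : 𝒳 × Ybin → ℝ) (hP0 : ∀ ω, 0 ≤ P ω) (hP1 : ∑ ω, P ω = 1)
    (hnoiseless : condEnt P (fun ω => ω.2) (fun ω => ω.1) = 0)
    (f : 𝒳 → ℝ) (hf : ∀ x, f x ∈ Set.Icc (-1 : ℝ) 1) (hrisk : risk P f = 0) :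
    mi P (fun ω => f ω.1) (fun ω => ω.2) = mi P (fun ω => ω.1) (fun ω => ω.2) ∧
      mi P (fun ω => ω.1) (fun ω => ω.2) = ent P (fun ω => ω.2) := by
  have hlabel : ∀ ω ω', P ω ≠ 0 → P ω' ≠ 0 → f ω'.1 = f ω.1 → ω'.2 = ω.2 := by
    intro ω ω' hω hω' hfeq
    have hsign := sign_eq_label_of_risk_eq_zero hP0 hrisk hω'
    rw [hfeq, sign_eq_label_of_risk_eq_zero hP0 hrisk hω] at hsign
    exact Subtype.ext (by exact_mod_cast hsign.symm)
  have hX : mi P (fun ω => ω.1) (fun ω => ω.2) = ent P (fun ω => ω.2) :=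
    mi_eq_ent_of_determines hP0 fun ω ω' hω hω' hx => hlabel ω ω' hω hω' (congrArg f hx)
  exact ⟨(mi_eq_ent_of_determines hP0 hlabel).trans hX.symm, hX⟩
end
end
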